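/- For all real numbers α and θ and all integers n, m, k, l with 1 ≤ n < m and 0 ≤ k ≤ l, the quantities d_{n,k}^{m,l} satisfy the backward (Chapman–Kolmogorov-type) recursion d_{n,k}^{m,l} = Σ_{j=k}^{l} C(l, l−j) ((α+θ)_{m−1↑})^{l−j} (θ+m−1)^{j} d_{n,k}^{m−1,j}. (Core algebraic content of Proposition 2.2 on the cotransition probabilities.) -/

import Mathlib

open scoped BigOperators

/-- Rising factorial `(x)_{j↑} = x(x+1)⋯(x+j-1)`. -/
noncomputable def risingFac (x : ℝ) (j : ℕ) : ℝ :=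
  ∏ i ∈ Finset.range j, (x + i)

/-- Falling factorial `(x)_{j↓} = x(x-1)⋯(x-j+1)`. -/
noncomputable def fallingFac (x : ℝ) (j : ℕ) : ℝ :=
  ∏ i ∈ Finset.range j, (x - i)

/-- `S_{n,m} = Σ_{i=1}^{m−n} (α+θ)_{m−i↑} (θ+m−1)_{i−1↓}`. -/
noncomputable def Scot (α θ : ℝ) (n m : ℕ) : ℝ :=
  ∑ i ∈ Finset.Icc 1 (m - n),
    risingFac (α + θ) (m - i) * fallingFac (θ + (m : ℝ) - 1) (i - 1)

/-- `d_{n,k}^{m,l} = C(l,k) ((θ+n)_{m−n↑})^k (S_{n,m})^{l−k}`. -/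
noncomputable def dcot (α θ : ℝ) (n k m l : ℕ) : ℝ :=
  (Nat.choose l k : ℝ) * (risingFac (θ + (n : ℝ)) (m - n)) ^ k *
    (Scot α θ n m) ^ (l - k)

theorem risingFac_succ (x : ℝ) (j : ℕ) : risingFac x (j + 1) = risingFac x j * (x + j) :=
  Finset.prod_range_succ _ _

theorem fallingFac_succ (x : ℝ) (j : ℕ) : fallingFac x (j + 1) = x * fallingFac (x - 1) j := by
  rw [fallingFac, Finset.prod_range_succ', mul_comm, fallingFac, Nat.cast_zero, sub_zero]
  congr 1
  refine Finset.prod_congr rfl fun i _ => ?_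
  push_cast
  ring

theorem Scot_eq_sum_range (α θ : ℝ) (n m : ℕ) :
    Scot α θ n m = ∑ i ∈ Finset.range (m - n),
      risingFac (α + θ) (m - (i + 1)) * fallingFac (θ + (m : ℝ) - 1) i := by
  rw [Finset.range_eq_Ico]
  exact (Finset.sum_Ico_add'
    (fun i => risingFac (α + θ) (m - i) * fallingFac (θ + (m : ℝ) - 1) (i - 1)) 0 (m - n) 1).symm

theorem Scot_succ (α θ : ℝ) {n m : ℕ} (h : n ≤ m) :
    Scot α θ n (m + 1) = (θ + m) * Scot α θ n m + risingFac (α + θ) m := by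
  rw [Scot_eq_sum_range, Scot_eq_sum_range, Nat.succ_sub h, Finset.sum_range_succ',
    Finset.mul_sum]
  congr 1
  · refine Finset.sum_congr rfl fun i _ => ?_
    rw [fallingFac_succ, Nat.add_sub_add_right]
    push_cast
    rw [← add_assoc, add_sub_cancel_right]
    ring
  · simp [fallingFac]

/-- A binomial expansion weighted by `C(j, k)`. -/
theorem choose_mul_add_pow {R : Type*} [CommSemiring R] (x y : R) {k l : ℕ} (h : k ≤ l) :
    (l.choose k : R) * (x + y) ^ (l - k) =
      ∑ j ∈ Finset.Icc k l, (l.choose j : R) * (j.choose k : R) * x ^ (j - k) * y ^ (l - j) := by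
  obtain ⟨d, rfl⟩ := Nat.exists_eq_add_of_le h
  rw [← Finset.Ico_add_one_right_eq_Icc, Finset.sum_Ico_eq_sum_range, Nat.add_sub_cancel_left,
    add_assoc, Nat.add_sub_cancel_left, add_pow, Finset.mul_sum]
  refine Finset.sum_congr rfl fun i hi => ?_
  have hi : i ≤ d := Nat.lt_succ_iff.mp (Finset.mem_range.mp hi)
  have hc := Nat.choose_mul (n := k + d) (k := k + i) (s := k) (by omega)
  rw [Nat.add_sub_cancel_left, Nat.add_sub_cancel_left] at hc
  rw [← Nat.cast_mul, hc, Nat.add_sub_cancel_left, Nat.add_sub_add_left]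
  push_cast
  ring

/-- Backward (Chapman–Kolmogorov-type) recursion for the cotransition quantities
`d_{n,k}^{m,l}` (core algebraic content of Proposition 2.2). -/
theorem stmt_12
    (α θ : ℝ) (n m k l : ℕ) (hn : 1 ≤ n) (hnm : n < m) (hkl : k ≤ l) :
    dcot α θ n k m l =
      ∑ j ∈ Finset.Icc k l,
        (Nat.choose l (l - j) : ℝ) * (risingFac (α + θ) (m - 1)) ^ (l - j) *
          (θ + (m : ℝ) - 1) ^ j * dcot α θ n k (m - 1) j := by
  obtain ⟨p, rfl⟩ := Nat.exists_eq_add_one_of_ne_zero (Nat.ne_zero_of_lt hnm)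
  have hnp : n ≤ p := Nat.lt_succ_iff.mp hnm
  have hR : risingFac (θ + n) (p + 1 - n) = risingFac (θ + n) (p - n) * (θ + p) := by
    rw [Nat.succ_sub hnp, risingFac_succ, Nat.cast_sub hnp]
    ring
  have hT : θ + ((p + 1 : ℕ) : ℝ) - 1 = θ + p := by
    push_cast
    ring
  simp only [dcot, hR, hT, Nat.add_sub_cancel]
  rw [Scot_succ α θ hnp, mul_right_comm, choose_mul_add_pow _ _ hkl, Finset.sum_mul]
  refine Finset.sum_congr rfl fun j hj => ?_
  obtain ⟨hkj, hjl⟩ := Finset.mem_Icc.mp hj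
  rw [Nat.choose_symm hjl, ← pow_mul_pow_sub (θ + (p : ℝ)) hkj, mul_pow, mul_pow]
  ring
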